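/- Let n ≥ 2 and let μ be a nonzero positive Borel measure on ℝⁿ with ∫_{ℝⁿ} ∏_{ℓ=1}^n (1 + t_ℓ²)^{-1} dμ(t⃗) < ∞ that satisfies the Nevanlinna condition. Then μ has infinite total mass, μ(ℝⁿ) = ∞; in particular, μ cannot have compact support. -/

import Mathlib

open MeasureTheory
open scoped ComplexConjugate ENNReal

/-- The Nevanlinna condition on a positive Borel measure `μ` on `ℝⁿ`: for all
`z ∈ (ℂ⁺)ⁿ` and all indices `ℓ₁ < ℓ₂`,
`∫ (t_{ℓ₁} - z_{ℓ₁})⁻² (t_{ℓ₂} - conj z_{ℓ₂})⁻² ∏_{j ≠ ℓ₁, ℓ₂} (1/(t_j - z_j) - 1/(t_j - conj z_j)) dμ = 0`. -/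
def NevanlinnaCondition (n : ℕ) (μ : Measure (Fin n → ℝ)) : Prop :=
  ∀ z : Fin n → ℂ, (∀ k, 0 < (z k).im) → ∀ ℓ₁ ℓ₂ : Fin n, ℓ₁ < ℓ₂ →
    (∫ t : Fin n → ℝ,
      (((t ℓ₁ : ℂ) - z ℓ₁) ^ 2)⁻¹ * (((t ℓ₂ : ℂ) - conj (z ℓ₂)) ^ 2)⁻¹ *
        ∏ j ∈ Finset.univ \ {ℓ₁, ℓ₂},
          (1 / ((t j : ℂ) - z j) - 1 / ((t j : ℂ) - conj (z j))) ∂μ) = 0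

/-- The growth condition `∫_{ℝⁿ} ∏_ℓ (1 + t_ℓ²)⁻¹ dμ(t) < ∞`. -/
def HerglotzGrowthCondition (n : ℕ) (μ : Measure (Fin n → ℝ)) : Prop :=
  (∫⁻ t : Fin n → ℝ, ∏ ℓ, ENNReal.ofReal (1 / (1 + t ℓ ^ 2)) ∂μ) < ⊤

open Filter Topology

/-- The integrand of the Nevanlinna condition. -/
noncomputable def nevanlinnaKernel {n : ℕ} (ℓ₁ ℓ₂ : Fin n) (z : Fin n → ℂ) (t : Fin n → ℝ) : ℂ :=
  (((t ℓ₁ : ℂ) - z ℓ₁) ^ 2)⁻¹ * (((t ℓ₂ : ℂ) - conj (z ℓ₂)) ^ 2)⁻¹ *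
    ∏ j ∈ Finset.univ \ {ℓ₁, ℓ₂}, (1 / ((t j : ℂ) - z j) - 1 / ((t j : ℂ) - conj (z j)))

theorem one_le_norm_ofReal_sub_I (s : ℝ) : 1 ≤ ‖(s : ℂ) - Complex.I‖ := by
  simpa using Complex.abs_im_le_norm ((s : ℂ) - Complex.I)

theorem one_le_norm_ofReal_add_I (s : ℝ) : 1 ≤ ‖(s : ℂ) + Complex.I‖ := by
  simpa using Complex.abs_im_le_norm ((s : ℂ) + Complex.I)

theorem ofReal_sub_I_ne_zero (s : ℝ) : (s : ℂ) - Complex.I ≠ 0 :=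
  norm_pos_iff.mp (one_pos.trans_le (one_le_norm_ofReal_sub_I s))

theorem ofReal_add_I_ne_zero (s : ℝ) : (s : ℂ) + Complex.I ≠ 0 :=
  norm_pos_iff.mp (one_pos.trans_le (one_le_norm_ofReal_add_I s))

theorem continuous_nevanlinnaKernel_I {n : ℕ} (ℓ₁ ℓ₂ : Fin n) :
    Continuous (nevanlinnaKernel ℓ₁ ℓ₂ fun _ ↦ Complex.I) := by
  unfold nevanlinnaKernel
  simp only [Complex.conj_I, sub_neg_eq_add]
  refine ((Continuous.inv₀ (by fun_prop) fun t ↦ pow_ne_zero 2 (ofReal_sub_I_ne_zero _)).mul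
    (Continuous.inv₀ (by fun_prop) fun t ↦ pow_ne_zero 2 (ofReal_add_I_ne_zero _))).mul
    (continuous_finsetProd _ fun j _ ↦ ?_)
  exact (continuous_const.div (by fun_prop) fun t ↦ ofReal_sub_I_ne_zero _).sub
    (continuous_const.div (by fun_prop) fun t ↦ ofReal_add_I_ne_zero _)

theorem norm_nevanlinnaKernel_I_le {n : ℕ} (ℓ₁ ℓ₂ : Fin n) (t : Fin n → ℝ) :
    ‖nevanlinnaKernel ℓ₁ ℓ₂ (fun _ ↦ Complex.I) t‖ ≤
      2 ^ (Finset.univ \ {ℓ₁, ℓ₂} : Finset (Fin n)).card := by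
  simp only [nevanlinnaKernel, Complex.conj_I, sub_neg_eq_add, norm_mul, norm_inv, norm_pow,
    norm_prod]
  have h₁ := inv_le_one_of_one_le₀ (one_le_pow₀ (n := 2) (one_le_norm_ofReal_sub_I (t ℓ₁)))
  have h₂ := inv_le_one_of_one_le₀ (one_le_pow₀ (n := 2) (one_le_norm_ofReal_add_I (t ℓ₂)))
  refine (mul_le_of_le_one_left (by positivity) (mul_le_one₀ h₁ (by positivity) h₂)).trans ?_
  rw [← Finset.prod_const]
  refine Finset.prod_le_prod (fun _ _ ↦ norm_nonneg _) fun j _ ↦ (norm_sub_le _ _).trans ?_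
  simp only [one_div, norm_inv]
  linarith [inv_le_one_of_one_le₀ (one_le_norm_ofReal_sub_I (t j)),
    inv_le_one_of_one_le₀ (one_le_norm_ofReal_add_I (t j))]

theorem nevanlinnaKernel_I_zero_ne_zero {n : ℕ} (ℓ₁ ℓ₂ : Fin n) :
    nevanlinnaKernel ℓ₁ ℓ₂ (fun _ ↦ Complex.I) 0 ≠ 0 := by
  simp only [nevanlinnaKernel, Complex.conj_I, Pi.zero_apply, Complex.ofReal_zero, zero_sub]
  refine mul_ne_zero (by simp) (Finset.prod_ne_zero_iff.mpr fun j _ ↦ ?_)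
  norm_num [Complex.ext_iff]

theorem nevanlinnaKernel_I_inv_smul {n : ℕ} (ℓ₁ ℓ₂ : Fin n) {y : ℝ} (hy : y ≠ 0)
    (t : Fin n → ℝ) :
    nevanlinnaKernel ℓ₁ ℓ₂ (fun _ ↦ Complex.I) (y⁻¹ • t) =
      (y : ℂ) ^ 4 * (y : ℂ) ^ (Finset.univ \ {ℓ₁, ℓ₂} : Finset (Fin n)).card *
        nevanlinnaKernel ℓ₁ ℓ₂ (fun _ ↦ y * Complex.I) t := by
  have hy' : (y : ℂ) ≠ 0 := by exact_mod_cast hy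
  have h₁ (s : ℝ) : ((y⁻¹ * s : ℝ) : ℂ) - Complex.I = (y : ℂ)⁻¹ * (s - y * Complex.I) := by
    push_cast; field_simp
  have h₂ (s : ℝ) : ((y⁻¹ * s : ℝ) : ℂ) + Complex.I = (y : ℂ)⁻¹ * (s + y * Complex.I) := by
    push_cast; field_simp
  simp only [nevanlinnaKernel, Pi.smul_apply, smul_eq_mul, map_mul, Complex.conj_ofReal,
    Complex.conj_I, mul_neg, sub_neg_eq_add, h₁, h₂, mul_pow, mul_inv, one_div, inv_inv, inv_pow,
    ← mul_sub, Finset.prod_mul_distrib, Finset.prod_const]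
  ring

/-- A finite measure on `ℝⁿ`, `n ≥ 2`, satisfying the Nevanlinna condition vanishes. -/
theorem NevanlinnaCondition.eq_zero_of_isFiniteMeasure {n : ℕ} (hn : 2 ≤ n)
    {μ : Measure (Fin n → ℝ)} [IsFiniteMeasure μ] (h : NevanlinnaCondition n μ) : μ = 0 := by
  let ℓ₁ : Fin n := ⟨0, by omega⟩
  let ℓ₂ : Fin n := ⟨1, by omega⟩
  let G := nevanlinnaKernel ℓ₁ ℓ₂ fun _ ↦ Complex.I
  have hG : Continuous G := continuous_nevanlinnaKernel_I ℓ₁ ℓ₂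
  have hint : ∀ᶠ y : ℝ in atTop, ∫ t, G (y⁻¹ • t) ∂μ = 0 := by
    filter_upwards [eventually_gt_atTop 0] with y hy
    simp only [G, nevanlinnaKernel_I_inv_smul ℓ₁ ℓ₂ hy.ne', integral_const_mul]
    have := h (fun _ ↦ y * Complex.I) (fun _ ↦ by simpa using hy) ℓ₁ ℓ₂ (by simp [ℓ₁, ℓ₂])
    exact mul_eq_zero_of_right _ this
  have hlim : Tendsto (fun y : ℝ ↦ ∫ t, G (y⁻¹ • t) ∂μ) atTop (𝓝 (∫ _, G 0 ∂μ)) := by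
    refine tendsto_integral_filter_of_dominated_convergence
      (fun _ ↦ 2 ^ (Finset.univ \ {ℓ₁, ℓ₂} : Finset (Fin n)).card)
      (.of_forall fun y ↦ (hG.comp (continuous_const_smul _)).aestronglyMeasurable)
      (.of_forall fun y ↦ .of_forall fun t ↦ norm_nevanlinnaKernel_I_le ℓ₁ ℓ₂ _)
      (integrable_const _) (.of_forall fun t ↦ (hG.tendsto 0).comp ?_)
    simpa using (tendsto_inv_atTop_zero (𝕜 := ℝ)).smul_const t
  have h0 := tendsto_nhds_unique hlim (tendsto_const_nhds.congr' (hint.mono fun _ hy ↦ hy.symm))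
  rw [integral_const, smul_eq_zero, or_iff_left (nevanlinnaKernel_I_zero_ne_zero ℓ₁ ℓ₂),
    measureReal_eq_zero_iff] at h0
  exact Measure.measure_univ_eq_zero.mp h0

theorem HerglotzGrowthCondition.measure_lt_top_of_isCompact {n : ℕ} {μ : Measure (Fin n → ℝ)}
    (h : HerglotzGrowthCondition n μ) {K : Set (Fin n → ℝ)} (hK : IsCompact K) : μ K < ⊤ := by
  have hc : Continuous fun t : Fin n → ℝ ↦ ∏ ℓ, ENNReal.ofReal (1 / (1 + t ℓ ^ 2)) := by
    simp only [← ENNReal.ofReal_prod_of_nonneg fun ℓ _ ↦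
      one_div_nonneg.mpr (add_nonneg zero_le_one (sq_nonneg _))]
    exact ENNReal.continuous_ofReal.comp (continuous_finsetProd _ fun ℓ _ ↦
      continuous_const.div (by fun_prop) fun t ↦ by positivity)
  rcases K.eq_empty_or_nonempty with rfl | hne
  · simp
  obtain ⟨x, -, hx⟩ := hK.exists_isMinOn hne hc.continuousOn
  have hpos : ∏ ℓ, ENNReal.ofReal (1 / (1 + x ℓ ^ 2)) ≠ 0 :=
    Finset.prod_ne_zero_iff.mpr fun ℓ _ ↦ (ENNReal.ofReal_pos.mpr (by positivity)).ne'
  have htop : ∏ ℓ, ENNReal.ofReal (1 / (1 + x ℓ ^ 2)) ≠ ⊤ :=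
    ENNReal.prod_ne_top fun ℓ _ ↦ ENNReal.ofReal_ne_top
  calc μ K ≤ _ := measure_mono fun t ht ↦ hx ht
    _ ≤ _ := meas_ge_le_lintegral_div hc.aemeasurable hpos htop
    _ < ⊤ := ENNReal.div_lt_top h.ne hpos

/-- For `n ≥ 2`, a nonzero positive Borel measure `μ` on `ℝⁿ`
satisfying the growth condition and the Nevanlinna condition must have infinite total
mass; in particular it cannot have compact support (there is no compact set carrying
all of `μ`). -/
theorem stmt_18 (n : ℕ) (hn : 2 ≤ n) (μ : Measure (Fin n → ℝ)) (hμ : μ ≠ 0)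
    (hgrowth : HerglotzGrowthCondition n μ)
    (hnev : NevanlinnaCondition n μ) :
    μ Set.univ = ⊤ ∧ ¬∃ K : Set (Fin n → ℝ), IsCompact K ∧ μ Kᶜ = 0 := by
  have htop : μ Set.univ = ⊤ := by
    by_contra hfin
    have : IsFiniteMeasure μ := ⟨lt_top_iff_ne_top.mpr hfin⟩
    exact hμ (hnev.eq_zero_of_isFiniteMeasure hn)
  refine ⟨htop, fun ⟨K, hK, hKc⟩ ↦ ?_⟩
  have hle : μ Set.univ ≤ μ K + μ Kᶜ := by
    simpa using measure_union_le (μ := μ) K Kᶜ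
  rw [htop, hKc, add_zero] at hle
  exact (hgrowth.measure_lt_top_of_isCompact hK).not_ge hle
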